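/- Let G be a reduced module over Z_p (the integers localized at a prime p) of finite torsion-free rank with a decomposition basis {x₁, …, xₙ}. Set Gᵢ = ⟨xᵢ⟩⁰ ⊆ G for 1 ≤ i ≤ n, and let T be the direct sum of n−1 copies of the torsion submodule of G (so T is a reduced torsion module). Then G ⊕ T ≅_p G₁ ⊕ ⋯ ⊕ Gₙ; in fact, the set I of all height-preserving isomorphisms between finitely generated submodules of G ⊕ T and of G₁ ⊕ ⋯ ⊕ Gₙ that extend the canonical map ⟨x₁,…,xₙ⟩ → ⟨x₁,…,xₙ⟩ sending each xᵢ to itself is nonempty and has the back-and-forth property. -/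

import Mathlib

noncomputable section

namespace UlmW

universe u

variable {R : Type*} [CommRing R]

/-- The submodule `p^α M`, defined by transfinite recursion on `α`. -/
def ppow {M : Type u} [AddCommGroup M] [Module R M] (p : R) (α : Ordinal.{u}) :
    Submodule R M :=
  Ordinal.limitRecOn α ⊤ (fun _ S => Submodule.map (LinearMap.lsmul R M p) S)
    fun β _ ih => ⨅ (γ : Set.Iio β), ih γ.1 γ.2

open scoped Classical in
/-- The `p`-height of `x`, with `⊤` playing the role of `∞`. -/
def pheight {M : Type u} [AddCommGroup M] [Module R M] (p : R) (x : M) :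
    WithTop Ordinal.{u} :=
  if h : ∃ α : Ordinal.{u}, x ∈ ppow p α ∧ x ∉ ppow p (α + 1) then (h.choose : WithTop Ordinal)
  else ⊤

/-- `H⁰ = {x : ∃ a ≠ 0, a • x ∈ H}`. -/
def hull {M : Type u} [AddCommGroup M] [Module R M] (H : Submodule R M) : Set M :=
  {x | ∃ a : R, a ≠ 0 ∧ a • x ∈ H}

/-- `X` is a decomposition set with respect to the single prime `p`. -/
def IsDecompWrt {M : Type u} [AddCommGroup M] [Module R M] (p : R) (X : Set M) : Prop :=
  (LinearIndependent R (fun x : X => (x : M))) ∧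
  (∀ x ∈ X, ∀ a : R, a ≠ 0 → a • x ≠ 0) ∧
  (∀ s : Finset M, ↑s ⊆ X → ∀ c : M → R,
    pheight p (∑ x ∈ s, c x • x) = s.inf fun x => pheight p (c x • x))

/-- `X` is a decomposition set (with respect to every prime of `R`). -/
def IsDecompositionSet (R : Type*) [CommRing R] {M : Type u} [AddCommGroup M] [Module R M]
    (X : Set M) : Prop :=
  ∀ p : R, Prime p → IsDecompWrt p X

/-- partial decomposition basis, heights taken w.r.t. a fixed prime `p`. -/
def IsPDBWrt {M : Type u} [AddCommGroup M] [Module R M] (p : R) (C : Set (Set M)) : Prop :=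
  C.Nonempty ∧ (∀ X ∈ C, X.Finite) ∧ (∀ X ∈ C, IsDecompWrt p X) ∧
  ∀ X ∈ C, ∀ x : M, ∃ Y ∈ C, X ⊆ Y ∧ x ∈ hull (Submodule.span R Y)

/-- partial decomposition basis (heights w.r.t. all primes of `R`). -/
def IsPDB (R : Type*) [CommRing R] {M : Type u} [AddCommGroup M] [Module R M] (C : Set (Set M)) : Prop :=
  C.Nonempty ∧ (∀ X ∈ C, X.Finite) ∧ (∀ X ∈ C, IsDecompositionSet R X) ∧
  ∀ X ∈ C, ∀ x : M, ∃ Y ∈ C, X ⊆ Y ∧ x ∈ hull (Submodule.span R Y)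

/-- A partial isomorphism system `I : G ≅_p H`. -/
def IsPartialIsoSystem {M N : Type*} [AddCommGroup M] [Module R M]
    [AddCommGroup N] [Module R N] (I : Set (M →ₗ.[R] N)) : Prop :=
  I.Nonempty ∧
  (∀ f ∈ I, Function.Injective f.toFun) ∧
  (∀ f ∈ I, ∀ a : M, ∃ g ∈ I, f ≤ g ∧ a ∈ g.domain) ∧
  (∀ f ∈ I, ∀ b : N, ∃ g ∈ I, f ≤ g ∧ ∃ y : g.domain, g y = b)

/-- The Ulm sequence of `x`: `U(x) = (|pⁱ x|)ᵢ`. -/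
def UlmSeqOf {M : Type u} [AddCommGroup M] [Module R M] (p : R) (x : M) :
    ℕ → WithTop Ordinal.{u} :=
  fun i => pheight p ((p ^ i) • x)

/-- `u` is an Ulm sequence. -/
def IsUlmSeq (u : ℕ → WithTop Ordinal.{u}) : Prop :=
  ∀ i, (u i = ⊤ → u (i + 1) = ⊤) ∧ (u i ≠ ⊤ → u i < u (i + 1))

/-- Equivalence of Ulm sequences. -/
def UlmEquiv (u v : ℕ → WithTop Ordinal.{u}) : Prop :=
  ∃ m n : ℕ, ∀ i, u (i + n) = v (i + m)

/-- `X` contains at least `n` elements whose Ulm sequence is equivalent to `u`. -/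
def HasAtLeast {M : Type u} [AddCommGroup M] [Module R M] (p : R)
    (u : ℕ → WithTop Ordinal.{u}) (n : ℕ) (X : Set M) : Prop :=
  ∃ s : Finset M, ↑s ⊆ X ∧ n ≤ s.card ∧ ∀ x ∈ s, UlmEquiv (UlmSeqOf p x) u

/-- `ŵ_C(e,G)` where `e` is the class of the Ulm sequence `u`. -/
def wHat {M : Type u} [AddCommGroup M] [Module R M] (p : R) (C : Set (Set M))
    (u : ℕ → WithTop Ordinal.{u}) : ℕ∞ :=
  sSup {N : ℕ∞ | ∃ n : ℕ, N = (n : ℕ∞) ∧ ∃ X ∈ C, HasAtLeast p u n X}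

/-- `x` is proper with respect to `S`. -/
def IsProper {M : Type u} [AddCommGroup M] [Module R M] (p : R) (S : Submodule R M)
    (x : M) : Prop :=
  ∀ s ∈ S, pheight p (x + s) ≤ pheight p x

/-- `H` is a nice submodule. -/
def IsNice {M : Type u} [AddCommGroup M] [Module R M] (p : R) (H : Submodule R M) : Prop :=
  ∀ x : M, ∃ h ∈ H, ∀ h' ∈ H, pheight p (x + h') ≤ pheight p (x + h)

/-- The Ulm invariant `u_p(σ, M)`: the dimension of `(p^σ M)[p]/(p^{σ+1} M)[p]`
over the residue field `R/(p)`. -/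
def uCard (p : R) (M : Type u) [AddCommGroup M] [Module R M] (σ : Ordinal.{u}) :
    Cardinal :=
  let V : Submodule R M := ppow p σ ⊓ Submodule.torsionBy R M p
  let W : Submodule R V := (ppow p (σ + 1) ⊓ Submodule.torsionBy R M p).comap V.subtype
  Module.rank (R ⧸ Ideal.span {p})
    ((V ⧸ W) ⧸ (Ideal.span {p} • (⊤ : Submodule R (V ⧸ W))))

/-- `û_p(σ, M) = min (u_p(σ, M), ω)`. -/
def uHat (p : R) (M : Type u) [AddCommGroup M] [Module R M] (σ : Ordinal.{u}) : Cardinal :=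
  min (uCard p M σ) Cardinal.aleph0

/-- `û_p(∞, M) = min (dim (p^∞ M)[p], ω)`. -/
def uHatInf (p : R) (M : Type u) [AddCommGroup M] [Module R M] : Cardinal :=
  let V : Submodule R M := (⨅ α : Ordinal.{u}, ppow p α) ⊓ Submodule.torsionBy R M p
  min (Module.rank (R ⧸ Ideal.span {p})
    (V ⧸ (Ideal.span {p} • (⊤ : Submodule R V)))) Cardinal.aleph0

end UlmW

open UlmW

/-- The ideal `(p) ⊆ ℤ` is prime. -/
instance zpSpanPrime (p : ℤ) [hp : Fact (Prime p)] : (Ideal.span {p} : Ideal ℤ).IsPrime :=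
  (Ideal.span_singleton_prime hp.out.ne_zero).mpr hp.out

/-- `ℤ_(p)`, the integers localized at the prime `p`. -/
abbrev Zp (p : ℤ) [Fact (Prime p)] : Type :=
  Localization.AtPrime (Ideal.span {p} : Ideal ℤ)


universe u

open UlmW

namespace UlmW

section Powers

variable {R : Type*} [CommRing R] {M : Type u} [AddCommGroup M] [Module R M]

theorem ppow_zero (p : R) : (ppow p 0 : Submodule R M) = ⊤ :=
  Ordinal.limitRecOn_zero ..

theorem mem_ppow_add_one {p : R} {α : Ordinal.{u}} {m : M} :
    m ∈ ppow p (α + 1) ↔ ∃ v ∈ ppow p α, p • v = m := by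
  have h : (ppow p (α + 1) : Submodule R M) = (ppow p α).map (LinearMap.lsmul R M p) :=
    Ordinal.limitRecOn_add_one ..
  rw [h]
  simp

theorem smul_mem_ppow_add_one {p : R} {α : Ordinal.{u}} {m : M} (h : m ∈ ppow p α) :
    p • m ∈ ppow p (α + 1) :=
  mem_ppow_add_one.2 ⟨m, h, rfl⟩

theorem mem_ppow_of_isSuccLimit {p : R} {α : Ordinal.{u}} (hα : Order.IsSuccLimit α) {m : M} :
    m ∈ ppow p α ↔ ∀ β < α, m ∈ ppow p β := by
  have h : (ppow p α : Submodule R M) = ⨅ γ : Set.Iio α, ppow p γ.1 :=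
    Ordinal.limitRecOn_limit _ _ _ _ hα
  rw [h]
  simp

theorem ppow_add_one_le (p : R) (α : Ordinal.{u}) :
    (ppow p (α + 1) : Submodule R M) ≤ ppow p α := by
  intro m hm
  obtain ⟨v, hv, rfl⟩ := mem_ppow_add_one.1 hm
  exact Submodule.smul_mem _ _ hv

theorem ppow_antitone (p : R) : Antitone (fun α : Ordinal.{u} => (ppow p α : Submodule R M)) := by
  intro α β hαβ
  induction β using Ordinal.limitRecOn with
  | zero => rw [nonpos_iff_eq_zero.1 hαβ]
  | add_one β ih =>
    rcases hαβ.eq_or_lt with rfl | h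
    · exact le_rfl
    · exact (ppow_add_one_le p β).trans (ih (Order.lt_add_one_iff.1 h))
  | limit β hβ ih =>
    rcases hαβ.eq_or_lt with rfl | h
    · exact le_rfl
    · exact fun m hm => (mem_ppow_of_isSuccLimit hβ).1 hm α h

theorem le_pheight_iff {p : R} {m : M} {α : Ordinal.{u}} :
    (α : WithTop Ordinal.{u}) ≤ pheight p m ↔ m ∈ ppow p α := by
  unfold pheight
  split_ifs with h
  · obtain ⟨h₁, h₂⟩ := h.choose_spec
    rw [WithTop.coe_le_coe]
    refine ⟨fun hle => ppow_antitone p hle h₁, fun hm => ?_⟩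
    by_contra! hlt
    exact h₂ (ppow_antitone p (Order.add_one_le_of_lt hlt) hm)
  · refine ⟨fun _ => ?_, fun _ => le_top⟩
    push Not at h
    induction α using Ordinal.limitRecOn with
    | zero => simp [ppow_zero]
    | add_one β ih => exact h β (ih le_top)
    | limit β hβ ih => exact (mem_ppow_of_isSuccLimit hβ).2 fun γ hγ => ih γ hγ le_top

theorem pheight_eq_pheight_iff {N : Type u} [AddCommGroup N] [Module R N] {p : R} {m : M}
    {m' : N} :
    pheight p m = pheight p m' ↔ ∀ α : Ordinal.{u}, m ∈ ppow p α ↔ m' ∈ ppow p α := by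
  simp only [← le_pheight_iff]
  refine ⟨fun h α => by rw [h], fun h => le_antisymm ?_ ?_⟩ <;>
  refine WithTop.forall_coe_le_iff_le.1 fun a ha => ?_
  · exact (h a).1 ha
  · exact (h a).2 ha

theorem exists_ppow_eq_bot {p : R} (h : (⨅ α : Ordinal.{u}, (ppow p α : Submodule R M)) = ⊥) :
    ∃ α : Ordinal.{u}, (ppow p α : Submodule R M) = ⊥ := by
  have h' : ∀ m : M, ∃ α : Ordinal.{u}, m ≠ 0 → m ∉ ppow p α := by
    intro m
    by_contra! hm
    have : m ∈ (⨅ α : Ordinal.{u}, (ppow p α : Submodule R M)) :=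
      (Submodule.mem_iInf _).2 fun α => (hm α).2
    rw [h, Submodule.mem_bot] at this
    exact (hm 0).1 this
  choose f hf using h'
  refine ⟨⨆ m, f m, (Submodule.eq_bot_iff _).2 fun m hm => ?_⟩
  by_contra hne
  exact hf m hne (ppow_antitone p (Ordinal.le_iSup f m) hm)

theorem mem_ppow_prod {N : Type u} [AddCommGroup N] [Module R N] {p : R} {α : Ordinal.{u}}
    {z : M × N} : z ∈ ppow p α ↔ z.1 ∈ ppow p α ∧ z.2 ∈ ppow p α := by
  induction α using Ordinal.limitRecOn generalizing z with
  | zero => simp [ppow_zero]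
  | add_one β ih =>
    simp only [mem_ppow_add_one, ih]
    constructor
    · rintro ⟨v, ⟨h₁, h₂⟩, rfl⟩
      exact ⟨⟨v.1, h₁, rfl⟩, ⟨v.2, h₂, rfl⟩⟩
    · rintro ⟨⟨v, hv, h₁⟩, ⟨w, hw, h₂⟩⟩
      exact ⟨(v, w), ⟨hv, hw⟩, Prod.ext h₁ h₂⟩
  | limit β hβ ih =>
    simp only [mem_ppow_of_isSuccLimit hβ]
    exact ⟨fun h => ⟨fun γ hγ => ((ih γ hγ).1 (h γ hγ)).1, fun γ hγ => ((ih γ hγ).1 (h γ hγ)).2⟩,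
      fun h γ hγ => (ih γ hγ).2 ⟨h.1 γ hγ, h.2 γ hγ⟩⟩

theorem mem_ppow_pi {ι : Type} {N : ι → Type u} [∀ i, AddCommGroup (N i)] [∀ i, Module R (N i)]
    {p : R} {α : Ordinal.{u}} {z : ∀ i, N i} : z ∈ ppow p α ↔ ∀ i, z i ∈ ppow p α := by
  induction α using Ordinal.limitRecOn generalizing z with
  | zero => simp [ppow_zero]
  | add_one β ih =>
    simp only [mem_ppow_add_one, ih]
    constructor
    · rintro ⟨v, h, rfl⟩ i
      exact ⟨v i, h i, rfl⟩
    · intro h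
      choose v hv hpv using h
      exact ⟨v, hv, funext hpv⟩
  | limit β hβ ih =>
    simp only [mem_ppow_of_isSuccLimit hβ]
    exact ⟨fun h i γ hγ => (ih γ hγ).1 (h γ hγ) i, fun h γ hγ => (ih γ hγ).2 fun i => h i γ hγ⟩

/-- A submodule closed under division by `p` is isotype. -/
theorem mem_ppow_coe {p : R} {K : Submodule R M} (hK : ∀ m : M, p • m ∈ K → m ∈ K)
    {α : Ordinal.{u}} {m : K} : m ∈ ppow p α ↔ (m : M) ∈ ppow p α := by
  induction α using Ordinal.limitRecOn generalizing m with
  | zero => simp [ppow_zero]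
  | add_one β ih =>
    simp only [mem_ppow_add_one]
    constructor
    · rintro ⟨v, h, rfl⟩
      exact ⟨v, ih.1 h, rfl⟩
    · rintro ⟨v, h, hv⟩
      exact ⟨⟨v, hK v (hv ▸ m.2)⟩, ih.2 h, Subtype.ext hv⟩
  | limit β hβ ih =>
    simp only [mem_ppow_of_isSuccLimit hβ]
    exact ⟨fun h γ hγ => (ih γ hγ).1 (h γ hγ), fun h γ hγ => (ih γ hγ).2 (h γ hγ)⟩

end Powers

section Artinian

theorem isArtinian_of_smul_eq_zero {R : Type*} [CommRing R] [IsDomain R]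
    [IsDiscreteValuationRing R] {M : Type*} [AddCommGroup M] [Module R M] [Module.Finite R M]
    {r : R} (hr : r ≠ 0) (h : ∀ m : M, r • m = 0) : IsArtinian R M := by
  have hR : IsArtinian R (R ⧸ Ideal.span {r}) :=
    (isFiniteLength_iff_isNoetherian_isArtinian.1
      (isFiniteLength_quotient_span_singleton R (mem_nonZeroDivisors_of_ne_zero hr))).2
  obtain ⟨n, s, hs⟩ := Module.Finite.exists_fin (R := R) (M := M)
  let f : Fin n → (R ⧸ Ideal.span {r}) →ₗ[R] M := fun i =>
    Submodule.liftQ _ (LinearMap.toSpanSingleton R M (s i)) (by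
      rw [Ideal.span, Submodule.span_le]
      simp [h])
  refine isArtinian_of_surjective _ (LinearMap.lsum R (fun _ : Fin n => R ⧸ Ideal.span {r}) R f) ?_
  rw [← LinearMap.range_eq_top, eq_top_iff, ← hs, Submodule.span_le]
  rintro _ ⟨i, rfl⟩
  refine ⟨Pi.single i (Submodule.Quotient.mk 1), ?_⟩
  rw [LinearMap.lsum_piSingle]
  simp only [f, Submodule.liftQ_apply, LinearMap.toSpanSingleton_apply, one_smul]

/-- An additive relation on `V` which induces an injective endomorphism of the Artinian module
`V / W` is surjective modulo `W`. -/
theorem exists_mem_of_isArtinian {R : Type*} [CommRing R] {N : Type*} [AddCommGroup N]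
    [Module R N] {V W : Submodule R N} [IsArtinian R (V ⧸ W.comap V.subtype)]
    (σ : Submodule R (N × N)) (hV : ∀ z ∈ σ, z.2 ∈ V) (hW : ∀ z ∈ σ, z.1 ∈ W ↔ z.2 ∈ W)
    (htot : ∀ w ∈ V, ∃ w', (w, w') ∈ σ) {w' : N} (hw' : w' ∈ V) :
    ∃ z ∈ σ, w' - z.2 ∈ W := by
  choose j hj using fun w : V => htot w w.2
  let f : V →ₗ[R] V ⧸ W.comap V.subtype :=
    { toFun := fun w => Submodule.Quotient.mk ⟨j w, hV _ (hj w)⟩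
      map_add' := fun a b => by
        rw [← Submodule.Quotient.mk_add, Submodule.Quotient.eq]
        have := hW _ (σ.sub_mem (hj (a + b)) (σ.add_mem (hj a) (hj b)))
        simpa using this
      map_smul' := fun r a => by
        rw [RingHom.id_apply, ← Submodule.Quotient.mk_smul, Submodule.Quotient.eq]
        have := hW _ (σ.sub_mem (hj (r • a)) (σ.smul_mem r (hj a)))
        simpa using this }
  have hf : ∀ w : V, f w = 0 ↔ w ∈ W.comap V.subtype := fun w => by
    change Submodule.Quotient.mk _ = _ ↔ _
    rw [Submodule.Quotient.mk_eq_zero]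
    exact (hW _ (hj w)).symm
  have hker : W.comap V.subtype ≤ LinearMap.ker f := fun w hw => (hf w).2 hw
  have hinj : Function.Injective (Submodule.liftQ _ f hker) := by
    rw [← LinearMap.ker_eq_bot, Submodule.ker_liftQ_eq_bot _ _ _ fun w hw => (hf w).1 hw]
  obtain ⟨q, hq⟩ := IsArtinian.surjective_of_injective_endomorphism _ hinj
    (Submodule.Quotient.mk ⟨w', hw'⟩)
  obtain ⟨w, rfl⟩ := Submodule.Quotient.mk_surjective _ q
  refine ⟨_, hj w, ?_⟩
  have := (Submodule.Quotient.eq _).1 hq.symm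
  simpa using this

end Artinian

end UlmW

namespace UlmW

section Nice

variable {R : Type*} [CommRing R] {M : Type u} [AddCommGroup M] [Module R M]

/-- Niceness of `A`, phrased as attainment of heights in cosets at limit ordinals. -/
def IsLimitNice (p : R) (A : Submodule R M) : Prop :=
  ∀ (g : M) (l : Ordinal.{u}), Order.IsSuccLimit l →
    (∀ β < l, ∃ s ∈ A, g + s ∈ ppow p β) → ∃ s ∈ A, g + s ∈ ppow p l

theorem exists_pow_smul_mem_of_fg {p : R} {H A : Submodule R M} (hA : A.FG)
    (h : ∀ m : M, ∃ k : ℕ, p ^ k • m ∈ H) : ∃ k : ℕ, ∀ m ∈ A, p ^ k • m ∈ H := by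
  classical
  obtain ⟨s, rfl⟩ := hA
  choose k hk using h
  refine ⟨s.sup k, fun m hm => ?_⟩
  change m ∈ H.comap (LinearMap.lsmul R M (p ^ s.sup k))
  refine Submodule.span_le.2 (fun a ha => ?_) hm
  obtain ⟨d, hd⟩ := Nat.exists_eq_add_of_le (Finset.le_sup (f := k) (Finset.mem_coe.1 ha))
  change p ^ s.sup k • a ∈ H
  rw [hd, pow_add, mul_comm, mul_smul]
  exact H.smul_mem _ (hk a)

variable [IsDomain R] [IsDiscreteValuationRing R] {p : R}

theorem smul_mem_of_not_pow_dvd (hp : Irreducible p) {H : Submodule R M} {m : M} {c : R} {k : ℕ}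
    (hc : c • m ∈ H) (hk : ¬ p ^ (k + 1) ∣ c) : p ^ k • m ∈ H := by
  have hc0 : c ≠ 0 := by
    rintro rfl
    exact hk (dvd_zero _)
  obtain ⟨j, v, rfl⟩ := IsDiscreteValuationRing.eq_unit_mul_pow_irreducible hc0 hp
  have hj : j ≤ k := by
    by_contra! h
    exact hk ((pow_dvd_pow p h).mul_left _)
  have h₁ : p ^ j • m ∈ H := by
    have := H.smul_mem (↑v⁻¹ : R) hc
    rwa [smul_smul, ← mul_assoc, Units.inv_mul, one_mul] at this
  obtain ⟨d, rfl⟩ := Nat.exists_eq_add_of_le hj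
  rw [pow_add, mul_comm, mul_smul]
  exact H.smul_mem _ h₁

theorem exists_pow_smul_mem (hp : Irreducible p) {H : Submodule R M} {m : M} {c : R} (hc0 : c ≠ 0)
    (hc : c • m ∈ H) : ∃ k : ℕ, p ^ k • m ∈ H := by
  obtain ⟨j, v, rfl⟩ := IsDiscreteValuationRing.eq_unit_mul_pow_irreducible hc0 hp
  refine ⟨j, ?_⟩
  have := H.smul_mem (↑v⁻¹ : R) hc
  rwa [smul_smul, ← mul_assoc, Units.inv_mul, one_mul] at this

/-- Below a limit ordinal, multiples of `x` of large height are `p ^ m`-divisible within multiples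
of `x` of prescribed height, up to multiples of `x` of height at least the limit. -/
theorem exists_divisible_part (hp : Irreducible p) (x : M) (m : ℕ) {l β : Ordinal.{u}}
    (hl : Order.IsSuccLimit l) (hβ : β < l) :
    ∃ γ < l, ∀ c : R, c • x ∈ ppow p γ →
      ∃ c' : R, (c - p ^ m * c') • x ∈ ppow p l ∧ c' • x ∈ ppow p β := by
  classical
  by_cases h₁ : ∃ k : ℕ, p ^ k • x ∈ ppow p l
  · suffices ∃ γ < l, ∀ c : R, c • x ∈ ppow p γ → c • x ∈ ppow p l by
      obtain ⟨γ, hγ, h⟩ := this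
      exact ⟨γ, hγ, fun c hc => ⟨0, by simpa using h c hc, by simp⟩⟩
    rcases hk : Nat.find h₁ with _ | k
    · have := Nat.find_spec h₁
      rw [hk, pow_zero, one_smul] at this
      exact ⟨β, hβ, fun c _ => Submodule.smul_mem _ _ this⟩
    · have hnot : p ^ k • x ∉ ppow p l := Nat.find_min h₁ (by omega)
      have hmem : p ^ (k + 1) • x ∈ ppow p l := hk ▸ Nat.find_spec h₁
      rw [mem_ppow_of_isSuccLimit hl] at hnot
      push Not at hnot
      obtain ⟨γ, hγ, hnot⟩ := hnot
      refine ⟨γ, hγ, fun c hc => ?_⟩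
      by_cases hdvd : p ^ (k + 1) ∣ c
      · obtain ⟨d, rfl⟩ := hdvd
        rw [mul_comm, mul_smul]
        exact Submodule.smul_mem _ _ hmem
      · exact absurd (smul_mem_of_not_pow_dvd hp hc hdvd) hnot
  · push Not at h₁
    by_cases h₂ : ∃ k : ℕ, p ^ k • x ∈ ppow p β
    · obtain ⟨k, hk⟩ := h₂
      have hnot := h₁ (k + m)
      rw [mem_ppow_of_isSuccLimit hl] at hnot
      push Not at hnot
      obtain ⟨γ, hγ, hnot⟩ := hnot
      refine ⟨γ, hγ, fun c hc => ?_⟩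
      by_cases hdvd : p ^ (k + m) ∣ c
      · obtain ⟨d, rfl⟩ := hdvd
        refine ⟨d * p ^ k, ?_, ?_⟩
        · have : p ^ (k + m) * d - p ^ m * (d * p ^ k) = 0 := by ring
          simp [this]
        · rw [mul_smul]
          exact Submodule.smul_mem _ _ hk
      · exact absurd (smul_mem_of_not_pow_dvd hp hc
          fun h => hdvd ((pow_dvd_pow p (Nat.le_succ _)).trans h)) hnot
    · push Not at h₂
      refine ⟨β, hβ, fun c hc => ⟨0, ?_, by simp⟩⟩
      by_cases hc0 : c = 0
      · simp [hc0]
      · obtain ⟨k, hk⟩ := exists_pow_smul_mem hp hc0 hc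
        exact absurd hk (h₂ k)

theorem isLimitNice_of_fg (hp : Irreducible p) {ι : Type} [Fintype ι] (x : ι → M)
    (hdec : ∀ (c : ι → R) (α : Ordinal.{u}), ∑ i, c i • x i ∈ ppow p α →
      ∀ i, c i • x i ∈ ppow p α)
    (htors : ∀ m : M, ∃ a : R, a ≠ 0 ∧ a • m ∈ Submodule.span R (Set.range x))
    {A : Submodule R M} (hA : A.FG) (hxA : ∀ i, x i ∈ A) : IsLimitNice p A := by
  intro g l hl hg
  have htors' : ∀ m : M, ∃ k : ℕ, p ^ k • m ∈ Submodule.span R (Set.range x) := fun m => by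
    obtain ⟨a, ha, h⟩ := htors m
    exact exists_pow_smul_mem hp ha h
  obtain ⟨m, hm⟩ : ∃ m : ℕ, ∀ s ∈ A, p ^ m • (g + s) ∈ Submodule.span R (Set.range x) := by
    obtain ⟨m, hm⟩ := exists_pow_smul_mem_of_fg (p := p)
      (hA.sup (Submodule.fg_span_singleton g)) htors'
    exact ⟨m, fun s hs => hm _ (add_comm g s ▸ Submodule.add_mem_sup hs
      (Submodule.mem_span_singleton_self g))⟩
  have hstrong : ∀ β < l, ∃ s ∈ A, g + s ∈ ppow p β ∧ p ^ m • (g + s) ∈ ppow p l := by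
    intro β hβ
    choose γ hγ hγc using fun i => exists_divisible_part hp (x i) m hl hβ
    have hsup : max β (Finset.univ.sup γ) < l :=
      max_lt hβ ((Finset.sup_lt_iff (bot_le.trans_lt hβ)).2 fun i _ => hγ i)
    obtain ⟨s, hs, hgs⟩ := hg _ hsup
    obtain ⟨c, hc⟩ := (Submodule.mem_span_range_iff_exists_fun R).1 (hm s hs)
    have hcmem := hdec c _ (hc ▸ Submodule.smul_mem _ _ hgs)
    choose c' hc₁ hc₂ using fun i => hγc i (c i) (ppow_antitone p
      ((Finset.le_sup (Finset.mem_univ i)).trans (le_max_right _ _)) (hcmem i))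
    refine ⟨s - ∑ i, c' i • x i,
      A.sub_mem hs (A.sum_mem fun i _ => A.smul_mem _ (hxA i)), ?_, ?_⟩
    · rw [← add_sub_assoc]
      exact Submodule.sub_mem _ (ppow_antitone p (le_max_left _ _) hgs)
        (Submodule.sum_mem _ fun i _ => hc₂ i)
    · rw [← add_sub_assoc, smul_sub, ← hc, Finset.smul_sum, ← Finset.sum_sub_distrib]
      refine Submodule.sum_mem _ fun i _ => ?_
      rw [smul_smul, ← sub_smul]
      exact hc₁ i
  let P : Ordinal.{u} → Submodule R M := fun β => ppow p β
  let D : Submodule R M := A ⊓ (P l).comap (LinearMap.lsmul R M (p ^ m))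
  have hDfg : Module.Finite R D := by
    have : IsNoetherian R A := isNoetherian_of_fg_of_noetherian A hA
    exact Module.Finite.iff_fg.2 ((isNoetherian_submodule.1 this) D inf_le_left)
  have hart : IsArtinian R (D ⧸ (P l).comap D.subtype) := by
    refine isArtinian_of_smul_eq_zero (pow_ne_zero m hp.ne_zero) fun q => ?_
    obtain ⟨d, rfl⟩ := Submodule.Quotient.mk_surjective _ q
    rw [← Submodule.Quotient.mk_smul, Submodule.Quotient.mk_eq_zero]
    exact d.2.2
  let F : Ordinal.{u} → Submodule R (D ⧸ (P l).comap D.subtype) := fun β =>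
    ((P β).comap D.subtype).map (Submodule.mkQ _)
  have hl0 : (0 : Ordinal.{u}) < l := bot_lt_iff_ne_bot.2 fun h => hl.1 (h ▸ isMin_bot)
  obtain ⟨_, ⟨β₀, hβ₀, rfl⟩, hmin⟩ := WellFounded.has_min
    (wellFounded_lt (α := Submodule R (D ⧸ (P l).comap D.subtype))) (F '' Set.Iio l)
    ⟨_, 0, hl0, rfl⟩
  obtain ⟨s₀, hs₀, hgs₀, hps₀⟩ := hstrong β₀ hβ₀
  refine ⟨s₀, hs₀, (mem_ppow_of_isSuccLimit hl).2 fun β hβ => ?_⟩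
  obtain ⟨s, hs, hgs, hps⟩ := hstrong (max β₀ β) (max_lt hβ₀ hβ)
  have hle : F (max β₀ β) ≤ F β₀ :=
    Submodule.map_mono (Submodule.comap_mono (ppow_antitone p (le_max_left _ _)))
  have heq : F β₀ ≤ F (max β₀ β) := by
    by_contra h
    exact hmin _ ⟨_, max_lt hβ₀ hβ, rfl⟩ (lt_of_le_not_ge hle h)
  have hsub : s - s₀ = (g + s) - (g + s₀) := by abel
  let d : D := ⟨s - s₀, A.sub_mem hs hs₀, by
    rw [hsub]
    exact Submodule.sub_mem _ hps hps₀⟩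
  have hd : Submodule.Quotient.mk d ∈ F β₀ := ⟨d, by
    change s - s₀ ∈ ppow p β₀
    rw [hsub]
    exact Submodule.sub_mem _ (ppow_antitone p (le_max_left _ _) hgs) hgs₀, rfl⟩
  obtain ⟨d', hd', hdd'⟩ := heq hd
  have h₁ : d' - d ∈ (P l).comap D.subtype := (Submodule.Quotient.eq _).1 hdd'
  have h₂ : (d' : M) ∈ ppow p β := ppow_antitone p (le_max_right _ _) hd'
  have h₃ : (d' : M) - (s - s₀) ∈ ppow p β := ppow_antitone p hβ.le h₁
  have h₄ := ppow_antitone p (le_max_right _ _) hgs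
  have : g + s₀ = (g + s) - d' + (d' - (s - s₀)) := by abel
  rw [this]
  exact Submodule.add_mem _ (Submodule.sub_mem _ h₄ h₂) h₃

end Nice

end UlmW

namespace UlmW

section Extension

variable {R : Type*} [CommRing R] {M N : Type u} [AddCommGroup M] [Module R M]
  [AddCommGroup N] [Module R N]

/-- An additive relation relating only elements of equal height. -/
def HeightPreserving (p : R) (Γ : Submodule R (M × N)) : Prop :=
  ∀ z ∈ Γ, ∀ α : Ordinal.{u}, z.1 ∈ ppow p α ↔ z.2 ∈ ppow p α

/-- The relation `Γ` read backwards. -/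
def converse (Γ : Submodule R (M × N)) : Submodule R (N × M) :=
  Γ.map (LinearEquiv.prodComm R M N : M × N →ₗ[R] N × M)

theorem mem_converse {Γ : Submodule R (M × N)} {z : N × M} :
    z ∈ converse Γ ↔ (z.2, z.1) ∈ Γ := by
  constructor
  · rintro ⟨w, hw, rfl⟩
    exact hw
  · intro h
    exact ⟨_, h, rfl⟩

theorem converse_fg {Γ : Submodule R (M × N)} (h : Γ.FG) : (converse Γ).FG :=
  h.map _

theorem HeightPreserving.converse {p : R} {Γ : Submodule R (M × N)} (h : HeightPreserving p Γ) :
    HeightPreserving p (converse Γ) :=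
  fun _ hz α => (h _ (mem_converse.1 hz) α).symm

/-- A height-preserving relation between the `p`-socles of `M` and `N` which is total on both
sides. -/
structure IsSocleEquiv (p : R) (Θ : Submodule R (M × N)) : Prop where
  heightPreserving : HeightPreserving p Θ
  smul_eq_zero : ∀ z ∈ Θ, p • z = 0
  exists_right : ∀ m : M, p • m = 0 → ∃ w, (m, w) ∈ Θ
  exists_left : ∀ w : N, p • w = 0 → ∃ m, (m, w) ∈ Θ

theorem IsSocleEquiv.converse {p : R} {Θ : Submodule R (M × N)} (h : IsSocleEquiv p Θ) :
    IsSocleEquiv p (converse Θ) where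
  heightPreserving := h.heightPreserving.converse
  smul_eq_zero z hz := by
    have := h.smul_eq_zero _ (mem_converse.1 hz)
    exact Prod.ext (congrArg Prod.snd this) (congrArg Prod.fst this)
  exists_right m hm := (h.exists_left m hm).imp fun _ => mem_converse.2
  exists_left m hm := (h.exists_right m hm).imp fun _ => mem_converse.2

theorem exists_proper_representative {p : R} {Γ : Submodule R (M × N)}
    (hred : ∃ α : Ordinal.{u}, (ppow p α : Submodule R M) = ⊥)
    (hnice : IsLimitNice p (Γ.map (LinearMap.fst R M N))) {a : M}
    (ha : a ∉ Γ.map (LinearMap.fst R M N)) :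
    ∃ z ∈ Γ, ∃ α : Ordinal.{u}, a + z.1 ∈ ppow p α ∧
      ∀ y ∈ Γ, a + z.1 + y.1 ∉ ppow p (α + 1) := by
  have hex : ∃ β : Ordinal.{u}, ∀ z ∈ Γ, a + z.1 ∉ ppow p β := by
    obtain ⟨β, hβ⟩ := hred
    refine ⟨β, fun z hz h => ha ⟨-z, Γ.neg_mem hz, ?_⟩⟩
    rw [hβ, Submodule.mem_bot] at h
    exact (eq_neg_of_add_eq_zero_left h).symm
  obtain ⟨β, hβ, hmin⟩ := WellFounded.has_min (wellFounded_lt (α := Ordinal.{u}))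
    {β | ∀ z ∈ Γ, a + z.1 ∉ ppow p β} hex
  have hlt : ∀ γ < β, ∃ z ∈ Γ, a + z.1 ∈ ppow p γ := by
    intro γ hγ
    by_contra! h
    exact hmin γ h hγ
  induction β using Ordinal.limitRecOn with
  | zero => exact absurd (by simp [ppow_zero]) (hβ 0 Γ.zero_mem)
  | add_one α _ =>
    obtain ⟨z, hz, hza⟩ := hlt α (Order.lt_add_one_iff.2 le_rfl)
    refine ⟨z, hz, α, hza, fun y hy => ?_⟩
    rw [add_assoc]
    exact hβ _ (Γ.add_mem hz hy)
  | limit β hl _ =>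
    obtain ⟨_, ⟨z, hz, rfl⟩, h⟩ := hnice a β hl fun γ hγ => by
      obtain ⟨z, hz, h⟩ := hlt γ hγ
      exact ⟨z.1, ⟨z, hz, rfl⟩, h⟩
    exact absurd h (hβ z hz)

variable [IsDomain R] [IsDiscreteValuationRing R] {p : R}

/-- If the relative Ulm invariant of the domain of `Γ` at `α` is nonzero, then so is that of the
range of `Γ`. -/
theorem exists_socle_element (hp : Irreducible p) {Γ Θ : Submodule R (M × N)} (hfg : Γ.FG)
    (hΓ : HeightPreserving p Γ) (hΘ : IsSocleEquiv p Θ) {α : Ordinal.{u}} {w₀ : M}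
    (hw₀ : p • w₀ = 0) (hw₀α : w₀ ∈ ppow p α)
    (hw₀A : ∀ z ∈ Γ, w₀ + z.1 ∉ ppow p (α + 1)) :
    ∃ w : N, p • w = 0 ∧ w ∈ ppow p α ∧ ∀ z ∈ Γ, w + z.2 ∉ ppow p (α + 1) := by
  by_contra! hcon
  let V : Submodule R N := ppow p α ⊓ LinearMap.ker (LinearMap.lsmul R N p)
  let W : Submodule R N := ppow p (α + 1)
  have hV : ∀ w : N, w ∈ V ↔ w ∈ ppow p α ∧ p • w = 0 := fun w => Iff.rfl
  -- every element of `V` is related to an element of the socle of `M`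
  have hlink : ∀ w ∈ V, ∃ z ∈ Γ, w - z.2 ∈ W ∧ ∃ u : M, p • u = 0 ∧ u ∈ ppow p α ∧
      u - z.1 ∈ ppow p (α + 1) := by
    intro w hw
    obtain ⟨z, hz, hwz⟩ := hcon w hw.2 hw.1
    have hz' : w - (-z).2 ∈ W := by simpa using hwz
    have hnz : -z ∈ Γ := Γ.neg_mem hz
    generalize -z = y at hz' hnz
    have hyα : y.2 ∈ ppow p α := by
      have := Submodule.sub_mem _ hw.1 (ppow_add_one_le p α hz')
      simpa using this
    have hpy : p • y.2 ∈ ppow p (α + 1 + 1) := by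
      have := smul_mem_ppow_add_one hz'
      rw [smul_sub, ((hV w).1 hw).2, zero_sub] at this
      simpa using Submodule.neg_mem _ this
    have hpy' : p • y.1 ∈ ppow p (α + 1 + 1) := (hΓ _ (Γ.smul_mem p hnz) _).2 hpy
    obtain ⟨v, hv, hpv⟩ := mem_ppow_add_one.1 hpy'
    refine ⟨y, hnz, hz', y.1 - v, by rw [smul_sub, hpv, sub_self],
      Submodule.sub_mem _ ((hΓ _ hnz α).2 hyα) (ppow_add_one_le p α hv), ?_⟩
    rw [sub_sub_cancel_left]
    exact Submodule.neg_mem _ hv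
  have hfin : IsArtinian R (V ⧸ W.comap V.subtype) := by
    have hB : (Γ.map (LinearMap.snd R M N)).FG := hfg.map _
    have : IsNoetherian R (Γ.map (LinearMap.snd R M N)) := isNoetherian_of_fg_of_noetherian _ hB
    have hBW : IsNoetherian R ((Γ.map (LinearMap.snd R M N)).map W.mkQ) :=
      isNoetherian_of_fg_of_noetherian _ (hB.map _)
    let f : V →ₗ[R] N ⧸ W := W.mkQ ∘ₗ V.subtype
    have hker : LinearMap.ker f = W.comap V.subtype := by
      rw [LinearMap.ker_comp, Submodule.ker_mkQ]
    have hrange : LinearMap.range f ≤ (Γ.map (LinearMap.snd R M N)).map W.mkQ := by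
      rintro _ ⟨w, rfl⟩
      obtain ⟨z, hz, hwz, -⟩ := hlink w w.2
      exact ⟨z.2, ⟨z, hz, rfl⟩, ((Submodule.Quotient.eq W).2 hwz).symm⟩
    have hQ : Module.Finite R (V ⧸ W.comap V.subtype) := by
      rw [← hker]
      have : Module.Finite R (LinearMap.range f) :=
        Module.Finite.iff_fg.2 (isNoetherian_submodule.1 hBW _ hrange)
      exact Module.Finite.equiv f.quotKerEquivRange.symm
    refine isArtinian_of_smul_eq_zero hp.ne_zero fun q => ?_
    obtain ⟨d, rfl⟩ := Submodule.Quotient.mk_surjective _ q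
    have : p • d = 0 := Subtype.ext d.2.2
    rw [← Submodule.Quotient.mk_smul, this, Submodule.Quotient.mk_zero]
  let σ : Submodule R (N × N) :=
    { carrier := {w | w.1 ∈ V ∧ ∃ z ∈ Γ, w.1 - z.2 ∈ W ∧ ∃ u : M, p • u = 0 ∧ u ∈ ppow p α ∧
        u - z.1 ∈ ppow p (α + 1) ∧ (u, w.2) ∈ Θ}
      zero_mem' := ⟨V.zero_mem, 0, Γ.zero_mem, by simp, 0, by simp, by simp, by simp, Θ.zero_mem⟩
      add_mem' := by
        rintro a b ⟨ha, z, hz, haz, u, hu, huα, huz, hua⟩ ⟨hb, y, hy, hby, v, hv, hvα, hvz, hvb⟩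
        refine ⟨V.add_mem ha hb, z + y, Γ.add_mem hz hy, ?_, u + v, by simp [hu, hv],
          Submodule.add_mem _ huα hvα, ?_, Θ.add_mem hua hvb⟩
        · simpa [add_sub_add_comm] using W.add_mem haz hby
        · simpa [add_sub_add_comm] using Submodule.add_mem _ huz hvz
      smul_mem' := by
        rintro r a ⟨ha, z, hz, haz, u, hu, huα, huz, hua⟩
        refine ⟨V.smul_mem r ha, r • z, Γ.smul_mem r hz, ?_, r • u, by rw [smul_comm, hu, smul_zero],
          Submodule.smul_mem _ r huα, ?_, Θ.smul_mem r hua⟩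
        · simpa [smul_sub] using W.smul_mem r haz
        · simpa [smul_sub] using Submodule.smul_mem _ r huz }
  have hσV : ∀ z ∈ σ, z.2 ∈ V := by
    rintro w ⟨-, _, -, -, u, -, huα, -, huw⟩
    exact ⟨(hΘ.heightPreserving _ huw α).1 huα, congrArg Prod.snd (hΘ.smul_eq_zero _ huw)⟩
  have hσW : ∀ z ∈ σ, z.1 ∈ W ↔ z.2 ∈ W := by
    rintro w ⟨-, z, hz, hwz, u, -, -, huz, huw⟩
    have h₁ : w.1 ∈ W ↔ z.2 ∈ W := by
      rw [← sub_add_cancel w.1 z.2]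
      exact Submodule.add_mem_iff_right W hwz
    have h₂ : u ∈ ppow p (α + 1) ↔ z.1 ∈ ppow p (α + 1) := by
      rw [← sub_add_cancel u z.1]
      exact Submodule.add_mem_iff_right _ huz
    exact h₁.trans ((hΓ _ hz _).symm.trans (h₂.symm.trans (hΘ.heightPreserving _ huw _)))
  have hσtot : ∀ w ∈ V, ∃ w', (w, w') ∈ σ := by
    intro w hw
    obtain ⟨z, hz, hwz, u, hu, huα, huz⟩ := hlink w hw
    obtain ⟨w', hw'⟩ := hΘ.exists_right u hu
    exact ⟨w', hw, z, hz, hwz, u, hu, huα, huz, hw'⟩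
  obtain ⟨w', hw'⟩ := hΘ.exists_right w₀ hw₀
  obtain ⟨y, ⟨-, z, hz, -, u, -, -, huz, huy⟩, hyw⟩ := exists_mem_of_isArtinian σ hσV hσW hσtot
    (w' := w') ⟨(hΘ.heightPreserving _ hw' α).1 hw₀α, congrArg Prod.snd (hΘ.smul_eq_zero _ hw')⟩
  have h₁ : w₀ - u ∈ ppow p (α + 1) := (hΘ.heightPreserving _ (Θ.sub_mem hw' huy) _).2 hyw
  refine hw₀A (-z) (Γ.neg_mem hz) ?_
  have := Submodule.add_mem _ h₁ huz
  simpa [sub_eq_add_neg, add_assoc] using this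

/-- Extending a height-preserving relation by one pair, with all the required heights prescribed. -/
theorem heightPreserving_sup_span (hp : Irreducible p) {Γ : Submodule R (M × N)}
    (hΓ : HeightPreserving p Γ) {a : M} {b : N} {α : Ordinal.{u}} (hab : (p • a, p • b) ∈ Γ)
    (ha : a ∈ ppow p α) (hb : b ∈ ppow p α) (haΓ : ∀ z ∈ Γ, a + z.1 ∉ ppow p (α + 1))
    (hbΓ : ∀ z ∈ Γ, b + z.2 ∉ ppow p (α + 1)) :
    HeightPreserving p (Γ ⊔ Submodule.span R {(a, b)}) := by
  intro z hz γ
  obtain ⟨y, hy, w, hw, rfl⟩ := Submodule.mem_sup.1 hz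
  obtain ⟨r, rfl⟩ := Submodule.mem_span_singleton.1 hw
  by_cases hr : p ∣ r
  · obtain ⟨r, rfl⟩ := hr
    refine hΓ _ (Γ.add_mem hy ?_) γ
    rw [mul_comm, mul_smul]
    exact Γ.smul_mem r hab
  · have hu : IsUnit r := by
      by_contra h
      rw [← mem_nonunits_iff, ← IsLocalRing.mem_maximalIdeal, hp.maximalIdeal_eq,
        Ideal.mem_span_singleton] at h
      exact hr h
    obtain ⟨r, rfl⟩ := hu
    have key : ∀ {L : Type u} [AddCommGroup L] [Module R L] (s c : L),
        s + (r : R) • c ∈ ppow p γ ↔ c + (↑r⁻¹ : R) • s ∈ ppow p γ := by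
      intro L _ _ s c
      have h : s + (r : R) • c = (r : R) • (c + (↑r⁻¹ : R) • s) := by
        rw [smul_add, smul_smul, Units.mul_inv, one_smul, add_comm]
      rw [h]
      refine ⟨fun h => ?_, fun h => Submodule.smul_mem _ _ h⟩
      have := Submodule.smul_mem _ (↑r⁻¹ : R) h
      rwa [smul_smul, Units.inv_mul, one_smul] at this
    have hy' : (↑r⁻¹ : R) • y ∈ Γ := Γ.smul_mem _ hy
    change y.1 + (r : R) • a ∈ _ ↔ y.2 + (r : R) • b ∈ _
    rw [key, key]
    by_cases hγ : γ ≤ α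
    · rw [Submodule.add_mem_iff_right _ (ppow_antitone p hγ ha),
        Submodule.add_mem_iff_right _ (ppow_antitone p hγ hb)]
      exact hΓ _ hy' γ
    · have hγ' := ppow_antitone (M := M) p (Order.add_one_le_of_lt (not_le.1 hγ))
      have hγ'' := ppow_antitone (M := N) p (Order.add_one_le_of_lt (not_le.1 hγ))
      exact iff_of_false (fun h => haΓ _ hy' (hγ' h)) fun h => hbΓ _ hy' (hγ'' h)

theorem exists_extension_of_smul_mem (hp : Irreducible p) {Γ Θ : Submodule R (M × N)}
    (hfg : Γ.FG) (hΓ : HeightPreserving p Γ) (hΘ : IsSocleEquiv p Θ)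
    (hred : ∃ α : Ordinal.{u}, (ppow p α : Submodule R M) = ⊥)
    (hnice : IsLimitNice p (Γ.map (LinearMap.fst R M N))) {a : M}
    (ha : p • a ∈ Γ.map (LinearMap.fst R M N)) :
    ∃ Γ' : Submodule R (M × N), Γ ≤ Γ' ∧ Γ'.FG ∧ HeightPreserving p Γ' ∧
      a ∈ Γ'.map (LinearMap.fst R M N) := by
  by_cases haΓ : a ∈ Γ.map (LinearMap.fst R M N)
  · exact ⟨Γ, le_rfl, hfg, hΓ, haΓ⟩
  obtain ⟨z, hz, α, hzα, hzΓ⟩ := exists_proper_representative hred hnice haΓ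
  suffices ∃ (a' : M) (b : N), (∃ y ∈ Γ, a' = a + y.1) ∧ (p • a', p • b) ∈ Γ ∧ a' ∈ ppow p α ∧
      b ∈ ppow p α ∧ (∀ y ∈ Γ, a' + y.1 ∉ ppow p (α + 1)) ∧
      (∀ y ∈ Γ, b + y.2 ∉ ppow p (α + 1)) by
    obtain ⟨a', b, ⟨y, hy, rfl⟩, hab, h₁, h₂, h₃, h₄⟩ := this
    refine ⟨Γ ⊔ Submodule.span R {(a + y.1, b)}, le_sup_left,
      hfg.sup (Submodule.fg_span_singleton _),
      heightPreserving_sup_span hp hΓ hab h₁ h₂ h₃ h₄, (a + y.1, b) - y,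
      Submodule.sub_mem _ (Submodule.mem_sup_right (Submodule.mem_span_singleton_self _))
        (Submodule.mem_sup_left hy), ?_⟩
    simp
  by_cases hbig : ∃ y ∈ Γ, a + y.1 ∈ ppow p α ∧ p • (a + y.1) ∈ ppow p (α + 1 + 1)
  · obtain ⟨y, hy, hya, hpy⟩ := hbig
    have hproper : ∀ t ∈ Γ, a + y.1 + t.1 ∉ ppow p (α + 1) := fun t ht h =>
      hzΓ (y + t - z) (Γ.sub_mem (Γ.add_mem hy ht) hz) (by
        convert! h using 1
        simp only [Prod.fst_sub, Prod.fst_add]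
        abel)
    obtain ⟨t, ht, hta⟩ : p • (a + y.1) ∈ Γ.map (LinearMap.fst R M N) := by
      rw [smul_add]
      exact Submodule.add_mem _ ha (Submodule.smul_mem _ _ ⟨y, hy, rfl⟩)
    change t.1 = _ at hta
    obtain ⟨v, hv, hpv⟩ := mem_ppow_add_one.1 hpy
    obtain ⟨v', hv', hpv'⟩ := mem_ppow_add_one.1 ((hΓ _ ht _).1 (hta ▸ hpy))
    obtain ⟨w, hpw, hw, hwΓ⟩ := exists_socle_element hp hfg hΓ hΘ (α := α) (w₀ := a + y.1 - v)
      (by rw [smul_sub, hpv, sub_self])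
      (Submodule.sub_mem _ hya (ppow_add_one_le p α hv)) fun s hs h => hproper s hs (by
        convert! Submodule.add_mem _ h hv using 1
        abel)
    refine ⟨a + y.1, v' + w, ⟨y, hy, rfl⟩, ?_, hya,
      Submodule.add_mem _ (ppow_add_one_le p α hv') hw, hproper, fun s hs h => hwΓ s hs ?_⟩
    · rw [smul_add p v', hpw, add_zero, hpv', ← hta]
      exact ht
    · convert! Submodule.sub_mem _ h hv' using 1
      abel
  · push Not at hbig
    obtain ⟨t, ht, hta⟩ : p • (a + z.1) ∈ Γ.map (LinearMap.fst R M N) := by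
      rw [smul_add]
      exact Submodule.add_mem _ ha (Submodule.smul_mem _ _ ⟨z, hz, rfl⟩)
    change t.1 = _ at hta
    obtain ⟨b, hb, hpb⟩ := mem_ppow_add_one.1
      ((hΓ _ ht (α + 1)).1 (hta ▸ smul_mem_ppow_add_one hzα))
    have hab : (p • (a + z.1), p • b) ∈ Γ := by
      rw [← hta, hpb]
      exact ht
    refine ⟨a + z.1, b, ⟨z, hz, rfl⟩, hab, hzα, hb, hzΓ, fun s hs h => ?_⟩
    have hsα : s.1 ∈ ppow p α :=
      (hΓ _ hs α).2 (by simpa using Submodule.sub_mem _ (ppow_add_one_le p α h) hb)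
    refine hbig (z + s) (Γ.add_mem hz hs) ?_ ?_
    · rw [Prod.fst_add, ← add_assoc]
      exact Submodule.add_mem _ hzα hsα
    · have h₁ := (hΓ _ (Γ.add_mem hab (Γ.smul_mem p hs)) (α + 1 + 1)).2 (by
        simpa using smul_mem_ppow_add_one h)
      simpa [add_assoc] using h₁

theorem exists_extension (hp : Irreducible p) {Θ : Submodule R (M × N)} (hΘ : IsSocleEquiv p Θ)
    (hred : ∃ α : Ordinal.{u}, (ppow p α : Submodule R M) = ⊥) {S : Submodule R M}
    (hS : ∀ m : M, ∃ c : R, c ≠ 0 ∧ c • m ∈ S)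
    (hnice : ∀ A : Submodule R M, A.FG → S ≤ A → IsLimitNice p A)
    {Γ : Submodule R (M × N)} (hfg : Γ.FG) (hΓ : HeightPreserving p Γ)
    (hSΓ : S ≤ Γ.map (LinearMap.fst R M N)) (a : M) :
    ∃ Γ' : Submodule R (M × N), Γ ≤ Γ' ∧ Γ'.FG ∧ HeightPreserving p Γ' ∧
      a ∈ Γ'.map (LinearMap.fst R M N) := by
  obtain ⟨c, hc, hca⟩ := hS a
  obtain ⟨k, hk⟩ := exists_pow_smul_mem hp hc (hSΓ hca)
  clear hca
  induction k generalizing a with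
  | zero => exact ⟨Γ, le_rfl, hfg, hΓ, by simpa using hk⟩
  | succ k ih =>
    rw [pow_succ, mul_smul] at hk
    obtain ⟨Γ₁, h₁, hfg₁, hΓ₁, hpa⟩ := ih (p • a) hk
    have hS₁ := hSΓ.trans (Submodule.map_mono h₁)
    obtain ⟨Γ₂, h₂, hfg₂, hΓ₂, ha⟩ := exists_extension_of_smul_mem hp hfg₁ hΓ₁ hΘ hred
      (hnice _ (hfg₁.map _) hS₁) hpa
    exact ⟨Γ₂, h₁.trans h₂, hfg₂, hΓ₂, ha⟩

end Extension

end UlmW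

namespace UlmW

section PartialIso

variable {R : Type*} [CommRing R] {p : R}
  {M N : Type u} [AddCommGroup M] [Module R M] [AddCommGroup N] [Module R N]

/-- A finite decomposition basis of a reduced module, as an indexed family. -/
structure IsDecompBasis (p : R) {ι : Type} [Fintype ι] (x : ι → M) : Prop where
  mem_ppow : ∀ (c : ι → R) (α : Ordinal.{u}), ∑ i, c i • x i ∈ ppow p α →
    ∀ i, c i • x i ∈ ppow p α
  torsion : ∀ m : M, ∃ a : R, a ≠ 0 ∧ a • m ∈ Submodule.span R (Set.range x)
  reduced : ∃ α : Ordinal.{u}, (ppow p α : Submodule R M) = ⊥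

/-- The height-preserving isomorphisms between finitely generated submodules which carry `x i` to
`y i`. -/
def heightIsos (p : R) {ι : Type} (x : ι → M) (y : ι → N) : Set (M →ₗ.[R] N) :=
  {f | Function.Injective f.toFun ∧ f.domain.FG ∧ (LinearMap.range f.toFun).FG ∧
    (∀ z : f.domain, pheight p (f z) = pheight p (z : M)) ∧
    ∀ i, ∃ h : x i ∈ f.domain, f ⟨x i, h⟩ = y i}

theorem mem_graph_pair {ι : Type} {x : ι → M} {y : ι → N} {f : M →ₗ.[R] N}
    (hf : f ∈ heightIsos p x y) (i : ι) : (x i, y i) ∈ f.graph := by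
  obtain ⟨h, hi⟩ := hf.2.2.2.2 i
  exact f.mem_graph_iff.2 ⟨⟨x i, h⟩, rfl, hi⟩

theorem heightPreserving_graph {ι : Type} {x : ι → M} {y : ι → N} {f : M →ₗ.[R] N}
    (hf : f ∈ heightIsos p x y) : HeightPreserving p f.graph := by
  intro z hz
  obtain ⟨m, h₁, h₂⟩ := f.mem_graph_iff.1 hz
  rw [← h₁, ← h₂]
  exact pheight_eq_pheight_iff.1 (hf.2.2.2.1 m).symm

theorem graph_fg {f : M →ₗ.[R] N} (hf : f.domain.FG) : f.graph.FG := by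
  have : Module.Finite R f.domain := Module.Finite.iff_fg.2 hf
  have h : f.graph = LinearMap.range (f.domain.subtype.prod f.toFun) := by
    ext z
    rw [LinearPMap.mem_graph_iff]
    exact exists_congr fun m => ⟨fun h => Prod.ext h.1 h.2,
      fun h => ⟨congrArg Prod.fst h, congrArg Prod.snd h⟩⟩
  rw [h]
  exact Module.Finite.iff_fg.1 inferInstance

theorem HeightPreserving.eq_zero_iff (hM : ∃ α : Ordinal.{u}, (ppow p α : Submodule R M) = ⊥)
    (hN : ∃ α : Ordinal.{u}, (ppow p α : Submodule R N) = ⊥) {Γ : Submodule R (M × N)}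
    (hΓ : HeightPreserving p Γ) {z : M × N} (hz : z ∈ Γ) : z.1 = 0 ↔ z.2 = 0 := by
  constructor
  · intro h
    obtain ⟨α, hα⟩ := hN
    rw [← Submodule.mem_bot R, ← hα, ← hΓ z hz, h]
    exact Submodule.zero_mem _
  · intro h
    obtain ⟨α, hα⟩ := hM
    rw [← Submodule.mem_bot R, ← hα, hΓ z hz, h]
    exact Submodule.zero_mem _

theorem toLinearPMap_mem_heightIsos (hM : ∃ α : Ordinal.{u}, (ppow p α : Submodule R M) = ⊥)
    (hN : ∃ α : Ordinal.{u}, (ppow p α : Submodule R N) = ⊥) {ι : Type} {x : ι → M} {y : ι → N}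
    {Γ : Submodule R (M × N)} (hfg : Γ.FG) (hΓ : HeightPreserving p Γ)
    (hxy : ∀ i, (x i, y i) ∈ Γ) :
    Γ.toLinearPMap.graph = Γ ∧ Γ.toLinearPMap ∈ heightIsos p x y := by
  have hzero : ∀ z ∈ Γ, z.1 = 0 → z.2 = 0 := fun z hz => (hΓ.eq_zero_iff hM hN hz).1
  have hgraph := Γ.toLinearPMap_graph_eq hzero
  refine ⟨hgraph, ?_, hfg.map _, ?_, fun z => ?_, fun i => ?_⟩
  · refine (injective_iff_map_eq_zero _).2 fun m hm => ?_
    have := Γ.mem_graph_toLinearPMap hzero m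
    exact Subtype.ext ((hΓ.eq_zero_iff hM hN this).2 hm)
  · rw [Γ.toLinearPMap_range hzero]
    exact hfg.map _
  · exact (pheight_eq_pheight_iff.2 (hΓ _ (Γ.mem_graph_toLinearPMap hzero z))).symm
  · have h := hxy i
    rw [← hgraph, LinearPMap.mem_graph_iff] at h
    obtain ⟨m, h₁, h₂⟩ := h
    change (m : M) = x i at h₁
    have hm : x i ∈ Γ.toLinearPMap.domain := h₁ ▸ m.2
    refine ⟨hm, ?_⟩
    have : m = ⟨x i, hm⟩ := Subtype.ext h₁
    rw [← this]
    exact h₂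

variable [IsDomain R] [IsDiscreteValuationRing R]

theorem IsDecompBasis.exists_extension (hp : Irreducible p) {ι : Type} [Fintype ι] {x : ι → M}
    (hx : IsDecompBasis p x) {Θ : Submodule R (M × N)} (hΘ : IsSocleEquiv p Θ)
    {Γ : Submodule R (M × N)} (hfg : Γ.FG) (hΓ : HeightPreserving p Γ)
    (hxΓ : ∀ i, x i ∈ Γ.map (LinearMap.fst R M N)) (a : M) :
    ∃ Γ' : Submodule R (M × N), Γ ≤ Γ' ∧ Γ'.FG ∧ HeightPreserving p Γ' ∧
      a ∈ Γ'.map (LinearMap.fst R M N) :=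
  UlmW.exists_extension hp hΘ hx.reduced hx.torsion
    (fun _ hA hSA => isLimitNice_of_fg hp x hx.mem_ppow hx.torsion hA
      fun i => hSA (Submodule.subset_span ⟨i, rfl⟩)) hfg hΓ
    (Submodule.span_le.2 (by rintro _ ⟨i, rfl⟩; exact hxΓ i)) a

theorem isPartialIsoSystem_heightIsos (hp : Irreducible p) {ι : Type} [Fintype ι] {x : ι → M}
    {y : ι → N} (hx : IsDecompBasis p x) (hy : IsDecompBasis p y)
    (hxy : ∀ (c : ι → R) (α : Ordinal.{u}), ∑ i, c i • x i ∈ ppow p α ↔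
      ∑ i, c i • y i ∈ ppow p α)
    {Θ : Submodule R (M × N)} (hΘ : IsSocleEquiv p Θ) :
    IsPartialIsoSystem (heightIsos p x y) := by
  refine ⟨?_, fun f hf => hf.1, fun f hf a => ?_, fun f hf b => ?_⟩
  · refine ⟨_, (toLinearPMap_mem_heightIsos hx.reduced hy.reduced
      (Γ := Submodule.span R (Set.range fun i => (x i, y i)))
      (Submodule.fg_span (Set.finite_range _)) (fun z hz α => ?_)
      fun i => Submodule.subset_span ⟨i, rfl⟩).2⟩
    obtain ⟨c, rfl⟩ := (Submodule.mem_span_range_iff_exists_fun R).1 hz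
    simpa [Prod.fst_sum, Prod.snd_sum] using hxy c α
  · obtain ⟨Γ, hle, hfg, hΓ, z, hz, rfl⟩ := hx.exists_extension hp hΘ (graph_fg hf.2.1)
      (heightPreserving_graph hf) (fun i => ⟨_, mem_graph_pair hf i, rfl⟩) a
    obtain ⟨hgraph, hmem⟩ := toLinearPMap_mem_heightIsos hx.reduced hy.reduced hfg hΓ
      fun i => hle (mem_graph_pair hf i)
    exact ⟨_, hmem, LinearPMap.le_of_le_graph (hgraph.symm ▸ hle), z, hz, rfl⟩
  · obtain ⟨Γ, hle, hfg, hΓ, z, hz, rfl⟩ := hy.exists_extension hp hΘ.converse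
      (converse_fg (graph_fg hf.2.1)) (heightPreserving_graph hf).converse
      (fun i => ⟨(y i, x i), mem_converse.2 (mem_graph_pair hf i), rfl⟩) b
    have hle' : f.graph ≤ converse Γ := fun w hw => mem_converse.2 (hle (mem_converse.2 hw))
    obtain ⟨hgraph, hmem⟩ := toLinearPMap_mem_heightIsos hx.reduced hy.reduced (converse_fg hfg)
      hΓ.converse fun i => hle' (mem_graph_pair hf i)
    refine ⟨_, hmem, LinearPMap.le_of_le_graph (hgraph.symm ▸ hle'), ?_⟩
    have hz' : (z.2, z.1) ∈ (converse Γ).toLinearPMap.graph := by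
      rw [hgraph]
      exact mem_converse.2 hz
    obtain ⟨m, -, hm⟩ := (LinearPMap.mem_graph_iff _).1 hz'
    exact ⟨m, hm⟩

end PartialIso

section Splitting

variable {R : Type*} [CommRing R] {p : R} {G : Type u} [AddCommGroup G] [Module R G]

theorem IsDecompWrt.smul_mem_ppow {n : ℕ} {x : Fin n → G} (hxinj : Function.Injective x)
    (h : IsDecompWrt p (Set.range x)) (c : Fin n → R) (α : Ordinal.{u}) :
    ∑ i, c i • x i ∈ ppow p α ↔ ∀ i, c i • x i ∈ ppow p α := by
  classical
  have h₁ := h.2.2 (Finset.univ.map ⟨x, hxinj⟩) (by simp) (Function.extend x c 0)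
  rw [Finset.sum_map, Finset.inf_map] at h₁
  simp only [Function.Embedding.coeFn_mk, hxinj.extend_apply] at h₁
  rw [← le_pheight_iff, h₁, Finset.le_inf_iff]
  simp [le_pheight_iff, hxinj.extend_apply]

theorem mem_of_smul_mem_of_ne_zero [IsDomain R] (hp : p ≠ 0) {H K : Submodule R G}
    (hK : (K : Set G) = {g | ∃ a : R, a ≠ 0 ∧ a • g ∈ H}) {m : G} (h : p • m ∈ K) : m ∈ K := by
  rw [← SetLike.mem_coe, hK] at h ⊢
  obtain ⟨a, ha, h⟩ := h
  exact ⟨a * p, mul_ne_zero ha hp, by rwa [mul_smul]⟩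

theorem isPartialIsoSystem_splitting [IsDomain R] [IsDiscreteValuationRing R] (hp : Irreducible p)
    (hred : (⨅ α : Ordinal.{u}, (ppow p α : Submodule R G)) = ⊥) (k : ℕ) (x : Fin (k + 1) → G)
    (hxinj : Function.Injective x) (hdec : IsDecompWrt p (Set.range x))
    (hbasis : ∀ g : G, ∃ a : R, a ≠ 0 ∧ a • g ∈ Submodule.span R (Set.range x))
    (tG : Submodule R G) (htG : (tG : Set G) = {g | ∃ a : R, a ≠ 0 ∧ a • g = 0})
    (Gi : Fin (k + 1) → Submodule R G)
    (hGi : ∀ i, (Gi i : Set G) = {g | ∃ a : R, a ≠ 0 ∧ a • g ∈ Submodule.span R {x i}})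
    (hxGi : ∀ i, x i ∈ Gi i) :
    IsPartialIsoSystem (heightIsos p (fun i => ((x i, 0) : G × (Fin k → tG)))
      fun i => (Pi.single i ⟨x i, hxGi i⟩ : (i : Fin (k + 1)) → Gi i)) := by
  classical
  have hp0 : p ≠ 0 := hp.ne_zero
  obtain ⟨α₀, hα₀⟩ := exists_ppow_eq_bot hred
  have htors : ∀ {g : G}, g ∈ tG ↔ ∃ a : R, a ≠ 0 ∧ a • g = 0 := fun {g} => by
    rw [← SetLike.mem_coe, htG, Set.mem_ofPred_eq]
  have htpow : ∀ {α : Ordinal.{u}} {m : tG}, m ∈ ppow p α ↔ (m : G) ∈ ppow p α :=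
    mem_ppow_coe fun m => mem_of_smul_mem_of_ne_zero (H := ⊥) hp0 (by simpa using htG)
  have hGpow : ∀ {i} {α : Ordinal.{u}} {m : Gi i}, m ∈ ppow p α ↔ (m : G) ∈ ppow p α :=
    fun {i} => mem_ppow_coe fun m => mem_of_smul_mem_of_ne_zero hp0 (hGi i)
  have hsocle : ∀ {i} {g : G}, p • g = 0 → g ∈ Gi i := fun {i g} h => by
    rw [← SetLike.mem_coe, hGi]
    exact ⟨p, hp0, h ▸ Submodule.zero_mem _⟩
  have hMpow : ∀ {α : Ordinal.{u}} {z : G × (Fin k → tG)}, z ∈ ppow p α ↔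
      z.1 ∈ ppow p α ∧ ∀ j, (z.2 j : G) ∈ ppow p α := by
    intro α z
    simp only [mem_ppow_prod, mem_ppow_pi, htpow]
  have hNpow : ∀ {α : Ordinal.{u}} {z : (i : Fin (k + 1)) → Gi i}, z ∈ ppow p α ↔
      ∀ i, (z i : G) ∈ ppow p α := by
    intro α z
    simp only [mem_ppow_pi, hGpow]
  have hxsum : ∀ (c : Fin (k + 1) → R), ∑ i, c i • ((x i, 0) : G × (Fin k → tG)) =
      (∑ i, c i • x i, 0) := fun c => by
    ext <;> simp [Prod.fst_sum, Prod.snd_sum]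
  have hysum : ∀ (c : Fin (k + 1) → R) (j : Fin (k + 1)),
      ((∑ i, c i • (Pi.single i ⟨x i, hxGi i⟩ : (i : Fin (k + 1)) → Gi i)) j : G) =
        c j • x j := fun c j => by
    rw [Finset.sum_apply, Finset.sum_eq_single j]
    · simp
    · intro i _ hij
      simp [Pi.single_eq_of_ne hij.symm]
    · simp
  have hxpow : ∀ (c : Fin (k + 1) → R) (α : Ordinal.{u}),
      ∑ i, c i • ((x i, 0) : G × (Fin k → tG)) ∈ ppow p α ↔ ∀ i, c i • x i ∈ ppow p α := by
    intro c α
    rw [hxsum, hMpow, hdec.smul_mem_ppow hxinj]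
    simp
  have hypow : ∀ (c : Fin (k + 1) → R) (α : Ordinal.{u}),
      ∑ i, c i • (Pi.single i ⟨x i, hxGi i⟩ : (i : Fin (k + 1)) → Gi i) ∈ ppow p α ↔
        ∀ i, c i • x i ∈ ppow p α := by
    intro c α
    rw [hNpow]
    simp only [hysum]
  have hx : IsDecompBasis p fun i => ((x i, 0) : G × (Fin k → tG)) := by
    refine ⟨fun c α h i => ?_, fun m => ?_, α₀, (Submodule.eq_bot_iff _).2 fun z hz => ?_⟩
    · rw [hMpow]
      simpa using (hxpow c α).1 h i
    · obtain ⟨a, ha, h⟩ := hbasis m.1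
      have htj : ∀ j, ∃ b : R, b ≠ 0 ∧ b • m.2 j = 0 := fun j => by
        obtain ⟨b, hb, h⟩ := htors.1 (m.2 j).2
        exact ⟨b, hb, Subtype.ext h⟩
      choose b hb hbm using htj
      refine ⟨(∏ j, b j) * a, mul_ne_zero (Finset.prod_ne_zero_iff.2 fun j _ => hb j) ha, ?_⟩
      have h₂ : (∏ j, b j) • m.2 = 0 := funext fun j => by
        rw [Pi.smul_apply, ← Finset.prod_erase_mul _ _ (Finset.mem_univ j), mul_smul, hbm,
          smul_zero, Pi.zero_apply]
      obtain ⟨c, hc⟩ := (Submodule.mem_span_range_iff_exists_fun R).1 h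
      rw [Submodule.mem_span_range_iff_exists_fun]
      refine ⟨fun i => (∏ j, b j) * c i, ?_⟩
      rw [hxsum]
      refine Prod.ext ?_ ?_
      · simp only [mul_smul, Prod.smul_fst, ← hc, Finset.smul_sum]
      · rw [Prod.smul_snd, mul_comm, mul_smul, h₂, smul_zero]
    · rw [hMpow, hα₀] at hz
      exact Prod.ext hz.1 (funext fun j => Subtype.ext (hz.2 j))
  have hy : IsDecompBasis p
      fun i => (Pi.single i ⟨x i, hxGi i⟩ : (i : Fin (k + 1)) → Gi i) := by
    refine ⟨fun c α h i => ?_, fun m => ?_, α₀, (Submodule.eq_bot_iff _).2 fun z hz => ?_⟩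
    · rw [hNpow]
      intro j
      rcases eq_or_ne j i with rfl | hij
      · simpa using (hypow c α).1 h j
      · simp [Pi.single_eq_of_ne hij]
    · have hmi : ∀ i, ∃ b : R, b ≠ 0 ∧ ∃ c : R, c • x i = b • (m i : G) := fun i => by
        have h := (m i).2
        rw [← SetLike.mem_coe, hGi] at h
        obtain ⟨b, hb, h⟩ := h
        exact ⟨b, hb, Submodule.mem_span_singleton.1 h⟩
      choose b hb c hc using hmi
      refine ⟨∏ i, b i, Finset.prod_ne_zero_iff.2 fun i _ => hb i, ?_⟩
      rw [Submodule.mem_span_range_iff_exists_fun]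
      refine ⟨fun i => (∏ j ∈ Finset.univ.erase i, b j) * c i, funext fun j => Subtype.ext ?_⟩
      rw [hysum, mul_smul, hc, ← mul_smul, Finset.prod_erase_mul _ _ (Finset.mem_univ j)]
      rfl
    · rw [hNpow, hα₀] at hz
      exact funext fun i => Subtype.ext (hz i)
  let Θ : Submodule R ((G × (Fin k → tG)) × ((i : Fin (k + 1)) → Gi i)) :=
    { carrier := {z | p • z = 0 ∧ (z.2 0 : G) = z.1.1 ∧ ∀ j : Fin k, (z.2 j.succ : G) = z.1.2 j}
      zero_mem' := by simp
      add_mem' := by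
        rintro a b ⟨ha, ha₁, ha₂⟩ ⟨hb, hb₁, hb₂⟩
        exact ⟨by rw [smul_add, ha, hb, add_zero], by simp [ha₁, hb₁], fun j => by
          simp [ha₂, hb₂]⟩
      smul_mem' := by
        rintro r a ⟨ha, ha₁, ha₂⟩
        exact ⟨by rw [smul_comm, ha, smul_zero], by simp [ha₁], fun j => by simp [ha₂]⟩ }
  have hΘ : IsSocleEquiv p Θ := by
    refine ⟨?_, fun z hz => hz.1, fun m hm => ?_, fun w hw => ?_⟩
    · rintro z ⟨-, h₁, h₂⟩ α
      rw [hMpow, hNpow, Fin.forall_fin_succ, h₁]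
      simp only [h₂]
    · have hm₁ : p • m.1 = 0 := congrArg Prod.fst hm
      have hm₂ : ∀ j, p • (m.2 j : G) = 0 := fun j =>
        congrArg Subtype.val (congrFun (congrArg Prod.snd hm) j)
      refine ⟨Fin.cons ⟨m.1, hsocle hm₁⟩ fun j => ⟨m.2 j, hsocle (hm₂ j)⟩,
        Prod.ext hm (funext fun i => Subtype.ext ?_), rfl, fun j => rfl⟩
      induction i using Fin.cases with
      | zero => exact hm₁
      | succ j => exact hm₂ j
    · have hw' : ∀ i, p • (w i : G) = 0 := fun i => congrArg Subtype.val (congrFun hw i)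
      exact ⟨(w 0, fun j => ⟨w j.succ, htors.2 ⟨p, hp0, hw' _⟩⟩),
        Prod.ext (Prod.ext (hw' 0) (funext fun j => Subtype.ext (hw' _))) hw, rfl, fun j => rfl⟩
  exact isPartialIsoSystem_heightIsos hp hx hy (fun c α => (hxpow c α).trans (hypow c α).symm) hΘ

end Splitting

end UlmW

theorem Zp.isDiscreteValuationRing (p : ℤ) [hp : Fact (Prime p)] :
    IsDiscreteValuationRing (Zp p) :=
  IsLocalization.AtPrime.isDiscreteValuationRing_of_dedekind_domain ℤ
    (P := Ideal.span {p}) (by simpa using hp.out.ne_zero) _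

theorem Zp.irreducible_intCast (p : ℤ) [hp : Fact (Prime p)] : Irreducible (p : Zp p) := by
  have := Zp.isDiscreteValuationRing p
  rw [IsDiscreteValuationRing.irreducible_iff_uniformizer, ← Localization.AtPrime.map_eq_maximalIdeal,
    Ideal.map_span, Set.image_singleton]
  simp

theorem statement_11 (p : ℤ) [Fact (Prime p)] {G : Type u} [AddCommGroup G]
    [Module (Zp p) G]
    (hred : (⨅ α : Ordinal.{u}, (ppow (p : Zp p) α : Submodule (Zp p) G)) = ⊥)
    (n : ℕ) (hn : 1 ≤ n) (x : Fin n → G) (hxinj : Function.Injective x)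
    (hdec : IsDecompWrt (p : Zp p) (Set.range x))
    (hbasis : ∀ g : G, ∃ a : Zp p, a ≠ 0 ∧ a • g ∈ Submodule.span (Zp p) (Set.range x))
    (tG : Submodule (Zp p) G)
    (htG : (tG : Set G) = {g | ∃ a : Zp p, a ≠ 0 ∧ a • g = 0})
    (Gi : Fin n → Submodule (Zp p) G)
    (hGi : ∀ i, (Gi i : Set G) =
      {g | ∃ a : Zp p, a ≠ 0 ∧ a • g ∈ Submodule.span (Zp p) {x i}})
    (hxGi : ∀ i, x i ∈ Gi i) :
    IsPartialIsoSystem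
      {f : (G × (Fin (n - 1) → ↥tG)) →ₗ.[Zp p] ((i : Fin n) → ↥(Gi i)) |
        Function.Injective f.toFun ∧ f.domain.FG ∧ (LinearMap.range f.toFun).FG ∧
        (∀ z : f.domain,
          pheight (p : Zp p) (f z) =
            pheight (p : Zp p) (z : G × (Fin (n - 1) → ↥tG))) ∧
        ∀ i : Fin n, ∃ h : ((x i, 0) ∈ f.domain),
          f ⟨(x i, 0), h⟩ = Pi.single i ⟨x i, hxGi i⟩} := by
  obtain ⟨k, rfl⟩ : ∃ k, n = k + 1 := ⟨n - 1, by omega⟩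
  have := Zp.isDiscreteValuationRing p
  exact isPartialIsoSystem_splitting (Zp.irreducible_intCast p) hred k x hxinj hdec hbasis tG htG
    Gi hGi hxGi

end
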